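/- Let Γ be a finitely generated residually finite group with finite symmetric generating set S, let Γ ⊳ Γ_1 ⊳ Γ_2 ⊳ … be a nested sequence of finite-index normal subgroups with ∩_{n=1}^∞ Γ_n = {1} and [Γ:Γ_n] → ∞, and let 𝒢 = {G_n} be the graph sequence of Cayley graphs of Γ/Γ_n with respect to the image of S. Then c(𝒢) − 1 ≤ rk grad{Γ,{Γ_n}} := liminf_{n→∞} d(Γ_n)/[Γ:Γ_n], where d(Γ_n) is the minimal number of generators of Γ_n. -/

import Mathlib

open Filter Function Set
open scoped Classical TensorProduct Pointwise symmDiff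

universe u

namespace GraphSeqPaper

/-- The space of `K`-valued antisymmetric functions supported on the (oriented) edges of `G`:
the `K`-vector space spanned by the edges with the convention `(x,y) = -(y,x)`. -/
def edgeSpace (K : Type*) [Field K] {V : Type u} (G : SimpleGraph V) :
    Submodule K (V → V → K) where
  carrier := {f | (∀ x y, ¬ G.Adj x y → f x y = 0) ∧ ∀ x y, f x y = - f y x}
  add_mem' := by
    rintro f g ⟨hf1, hf2⟩ ⟨hg1, hg2⟩
    refine ⟨fun x y h => ?_, fun x y => ?_⟩
    · simp only [Pi.add_apply, hf1 x y h, hg1 x y h, add_zero]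
    · simp only [Pi.add_apply, hf2 x y, hg2 x y]; ring
  zero_mem' := ⟨fun x y _ => rfl, fun x y => by simp⟩
  smul_mem' := by
    rintro c f ⟨hf1, hf2⟩
    refine ⟨fun x y h => ?_, fun x y => ?_⟩
    · simp only [Pi.smul_apply, hf1 x y h, smul_zero]
    · simp only [Pi.smul_apply, hf2 x y, smul_neg]

lemma edgeSpace_mono (K : Type*) [Field K] {V : Type u} {H G : SimpleGraph V}
    (h : H ≤ G) : edgeSpace K H ≤ edgeSpace K G :=
  fun f hf => ⟨fun x y hxy => hf.1 x y fun ha => hxy (h ha), hf.2⟩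

/-- The basis vector of `ε_K` associated to the oriented edge `(x,y)`. -/
noncomputable def edgeVec (K : Type*) [Field K] {V : Type u} (x y : V) : V → V → K :=
  fun a b => if a = x ∧ b = y then (1 : K) else if a = y ∧ b = x then (-1 : K) else 0

/-- The vector of a walk `(x₀, x₁, …, x_l)`, namely `Σ_{i} (x_i, x_{i+1})`. -/
noncomputable def walkVec (K : Type*) [Field K] {V : Type u} {G : SimpleGraph V} :
    ∀ {x y : V}, G.Walk x y → (V → V → K)
  | _, _, SimpleGraph.Walk.nil => 0
  | _, _, @SimpleGraph.Walk.cons _ _ a b _ _ p => edgeVec K a b + walkVec K p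

/-- `C^q_K(G)`: the subspace of `ε_K(G)` spanned by the vectors of cycles of length at most
`q`. -/
noncomputable def cycleSpace (K : Type*) [Field K] {V : Type u} (G : SimpleGraph V) (q : ℕ) :
    Submodule K (V → V → K) :=
  Submodule.span K
    {f | ∃ (x : V) (c : G.Walk x x), c.IsCycle ∧ c.length ≤ q ∧ f = walkVec K c}

/-- A graph sequence: finite simple graphs, of uniformly bounded vertex degrees, whose number
of vertices tends to infinity. -/
def IsGraphSeq (V : ℕ → Type u) (G : ∀ n, SimpleGraph (V n)) : Prop :=
  (∀ n, Finite (V n)) ∧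
    (∃ D : ℕ, ∀ n (x : V n), ((G n).neighborSet x).ncard ≤ D) ∧
      Tendsto (fun n => Nat.card (V n)) atTop atTop

/-- `ℋ ≺ 𝒢`: there is an integer `L > 0` with `d_{G_n}(x,y) ≤ L · d_{H_n}(x,y)` for all `n`
and all vertices `x, y`. -/
def Prec {V : ℕ → Type u} (H G : ∀ n, SimpleGraph (V n)) : Prop :=
  ∃ L : ℕ, 0 < L ∧ ∀ n (x y : V n), (G n).dist x y ≤ L * (H n).dist x y

/-- `𝒢 ≃ ℋ`: `ℋ ≺ 𝒢` and `𝒢 ≺ ℋ`. -/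
def GEquiv {V : ℕ → Type u} (G H : ∀ n, SimpleGraph (V n)) : Prop :=
  Prec H G ∧ Prec G H

/-- The edge number `e(𝒢) = liminf |E(G_n)|/|V(G_n)|`. -/
noncomputable def edgeNum {V : ℕ → Type u} (G : ∀ n, SimpleGraph (V n)) : ℝ :=
  liminf (fun n => ((G n).edgeSet.ncard : ℝ) / (Nat.card (V n) : ℝ)) atTop

/-- The cost `c(𝒢) = inf { e(ℋ) : ℋ ≃ 𝒢 }`. -/
noncomputable def cost {V : ℕ → Type u} (G : ∀ n, SimpleGraph (V n)) : ℝ :=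
  sInf {r : ℝ | ∃ H : ∀ n, SimpleGraph (V n), IsGraphSeq V H ∧ GEquiv G H ∧ r = edgeNum H}

/-- `s^q_K(𝒢) = liminf (|E(G_n)| - dim_K C^q_K(G_n))/|V(G_n)| - 1`. -/
noncomputable def sInv (K : Type*) [Field K] {V : ℕ → Type u}
    (G : ∀ n, SimpleGraph (V n)) (q : ℕ) : ℝ :=
  liminf (fun n =>
    (((G n).edgeSet.ncard : ℝ) - (Module.finrank K (cycleSpace K (G n) q) : ℝ)) /
      (Nat.card (V n) : ℝ)) atTop - 1

/-- `β_K(𝒢) = inf_q s^q_K(𝒢)`. -/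
noncomputable def beta (K : Type*) [Field K] {V : ℕ → Type u}
    (G : ∀ n, SimpleGraph (V n)) : ℝ :=
  ⨅ q : ℕ, sInv K G q

/-- A large girth sequence: for every `k ≥ 1`, all but finitely many `G_n` contain no cycle of
length at most `k`. -/
def LargeGirth {V : ℕ → Type u} (G : ∀ n, SimpleGraph (V n)) : Prop :=
  ∀ k : ℕ, 1 ≤ k → ∃ N : ℕ, ∀ n, N ≤ n →
    ∀ (x : V n) (c : (G n).Walk x x), c.IsCycle → k < c.length

/-- The set of edges of `G` whose two endpoints lie in different classes of the partition given
by the fibres of `P`. -/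
def crossEdges {V : Type u} (G : SimpleGraph V) (P : V → ℕ) : Set (Sym2 V) :=
  {e | e ∈ G.edgeSet ∧ ∃ x ∈ e, ∃ y ∈ e, P x ≠ P y}

/-- Hyperfiniteness of a graph sequence. -/
def Hyperfinite {V : ℕ → Type u} (G : ∀ n, SimpleGraph (V n)) : Prop :=
  ∀ ε : ℝ, 0 < ε → ∃ Kb : ℕ, ∃ P : ∀ n, V n → ℕ,
    (∀ n i, {x : V n | P n x = i}.ncard ≤ Kb) ∧
      liminf (fun n => ((crossEdges (G n) (P n)).ncard : ℝ) / (Nat.card (V n) : ℝ)) atTop ≤ ε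

/-- The Cayley graph of a group with respect to a (symmetric) set `T`:
`x ~ y` iff `x ≠ y` and `y x⁻¹ ∈ T` (or `x y⁻¹ ∈ T`). -/
def cayley (Q : Type u) [Group Q] (T : Set Q) : SimpleGraph Q :=
  SimpleGraph.fromRel (fun x y => y * x⁻¹ ∈ T)

/-- The Cayley graph of the quotient `Γ ⧸ N` with respect to the image of `S`. -/
def cayleyQuot {Γ : Type u} [Group Γ] (N : Subgroup Γ) (hN : N.Normal) (S : Set Γ) :
    SimpleGraph (Γ ⧸ N) :=
  haveI := hN
  cayley (Γ ⧸ N) ((fun g => (QuotientGroup.mk g : Γ ⧸ N)) '' S)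

/-- The minimal number of generators of a group. -/
noncomputable def minGens (Λ : Type u) [Group Λ] : ℕ :=
  sInf {d : ℕ | ∃ T : Set Λ, T.Finite ∧ T.ncard = d ∧ Subgroup.closure T = ⊤}

/-- A group is finitely presented. -/
def FinitelyPresentedGroup (Γ : Type u) [Group Γ] : Prop :=
  ∃ (n : ℕ) (f : FreeGroup (Fin n) →* Γ) (R : Set (FreeGroup (Fin n))),
    Surjective f ∧ R.Finite ∧ f.ker = Subgroup.normalClosure R

/-- Amenability via the Følner condition. -/
def IsAmenableFolner (Γ : Type u) [Group Γ] : Prop :=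
  ∀ F : Set Γ, F.Finite → ∀ ε : ℝ, 0 < ε →
    ∃ A : Set Γ, A.Finite ∧ A.Nonempty ∧
      ∀ s ∈ F, (((s • A) ∆ A).ncard : ℝ) ≤ ε * A.ncard

/-- The set of edges of `G` joining `F` to its complement. -/
def edgeBoundary {V : Type u} (G : SimpleGraph V) (F : Set V) : Set (Sym2 V) :=
  {e | e ∈ G.edgeSet ∧ ∃ x ∈ e, ∃ y ∈ e, x ∈ F ∧ y ∉ F}

theorem edist_le_mul_length {V : Type*} {G H : SimpleGraph V} {L : ℕ}
    (hGH : ∀ x y, H.Adj x y → G.edist x y ≤ L) {x y : V} (p : H.Walk x y) :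
    G.edist x y ≤ (L * p.length : ℕ) := by
  induction p with
  | nil => simp
  | cons h p ih =>
    refine (G.edist_triangle).trans ((add_le_add (hGH _ _ h) ih).trans (le_of_eq ?_))
    rw [SimpleGraph.Walk.length_cons]
    push_cast
    ring

theorem prec_of_edist_le {V : ℕ → Type u} {G H : ∀ n, SimpleGraph (V n)} {L M : ℕ}
    (hGH : ∀ n x y, (H n).Adj x y → (G n).edist x y ≤ L)
    (hHG : ∀ n x y, (G n).Adj x y → (H n).edist x y ≤ M) : Prec H G := by
  refine ⟨L + 1, L.succ_pos, fun n x y => ?_⟩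
  by_cases hr : (H n).Reachable x y
  · obtain ⟨p, hp⟩ := hr.exists_walk_length_eq_dist
    have h := edist_le_mul_length (hGH n) p
    have hr' : (G n).Reachable x y :=
      SimpleGraph.reachable_of_edist_ne_top (ne_top_of_le_ne_top (ENat.natCast_ne_top _) h)
    rw [← hr'.coe_dist_eq_edist, Nat.cast_le, hp] at h
    exact h.trans (Nat.mul_le_mul_right _ L.le_succ)
  · have hnr : ¬ (G n).Reachable x y := by
      rintro ⟨p⟩
      exact hr (SimpleGraph.reachable_of_edist_ne_top
        (ne_top_of_le_ne_top (ENat.natCast_ne_top _) (edist_le_mul_length (hHG n) p)))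
    simp [SimpleGraph.dist_eq_zero_of_not_reachable hnr]

/-- The graph on a group `Q` joining `x ∈ K` to `u * x` for every `u ∈ U`. -/
def translateGraph {Q : Type*} [Group Q] (K : Subgroup Q) (U : Set Q) : SimpleGraph Q :=
  SimpleGraph.fromRel fun x y => x ∈ K ∧ y * x⁻¹ ∈ U

section translateGraph

variable {Q : Type*} [Group Q] {K : Subgroup Q} {U : Set Q}

theorem translateGraph_adj {x y : Q} : (translateGraph K U).Adj x y ↔
    x ≠ y ∧ ((x ∈ K ∧ y * x⁻¹ ∈ U) ∨ (y ∈ K ∧ x * y⁻¹ ∈ U)) :=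
  SimpleGraph.fromRel_adj _ _ _

theorem translateGraph_edist_le_one {x u : Q} (hx : x ∈ K) (hu : u ∈ U) :
    (translateGraph K U).edist x (u * x) ≤ 1 := by
  rw [SimpleGraph.edist_le_one_iff_adj_or_eq, or_iff_not_imp_right]
  intro hne
  exact translateGraph_adj.2 ⟨hne, Or.inl ⟨hx, by simpa using hu⟩⟩

theorem ncard_neighborSet_translateGraph_le (hU : U.Finite) (x : Q) :
    ((translateGraph K U).neighborSet x).ncard ≤ 2 * U.ncard := by
  have hsub : (translateGraph K U).neighborSet x ⊆
      (fun u => u * x) '' U ∪ (fun u => u⁻¹ * x) '' U := by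
    intro y hy
    obtain ⟨-, ⟨-, h⟩ | ⟨-, h⟩⟩ := translateGraph_adj.1 hy
    · exact Or.inl ⟨_, h, by simp⟩
    · exact Or.inr ⟨_, h, by simp⟩
  have hle := (Set.ncard_le_ncard hsub ((hU.image _).union (hU.image _))).trans
    (Set.ncard_union_le _ _)
  have h₁ := Set.ncard_image_le (f := fun u => u * x) hU
  have h₂ := Set.ncard_image_le (f := fun u => u⁻¹ * x) hU
  omega

theorem ncard_edgeSet_translateGraph_le [Finite Q] :
    (translateGraph K U).edgeSet.ncard ≤ Nat.card K * U.ncard := by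
  have hsub : (translateGraph K U).edgeSet ⊆
      (fun p : Q × Q => s(p.1, p.2 * p.1)) '' ((K : Set Q) ×ˢ U) := by
    intro e
    induction e using Sym2.ind with
    | _ x y =>
      intro he
      obtain ⟨-, ⟨hx, h⟩ | ⟨hy, h⟩⟩ := translateGraph_adj.1 he
      · exact ⟨(x, y * x⁻¹), ⟨hx, h⟩, by simp⟩
      · exact ⟨(y, x * y⁻¹), ⟨hy, h⟩, by simp [Sym2.eq_swap]⟩
  refine (Set.ncard_le_ncard hsub (Set.toFinite _)).trans
    ((Set.ncard_image_le (Set.toFinite _)).trans (le_of_eq ?_))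
  rw [Set.ncard_prod]
  rfl

end translateGraph

theorem exists_edist_mul_le {ι Γ : Type*} {Q : ι → Type*} [Group Γ] [∀ n, Group (Q n)]
    (f : ∀ n, Γ →* Q n) (G : ∀ n, SimpleGraph (Q n)) {K : Subgroup Γ} {T A : Set Γ}
    (hTK : T ⊆ K) (hG : ∀ t ∈ T, ∀ n, ∀ h ∈ K, (G n).edist (f n h) (f n (t * h)) ≤ 1)
    (hA : A.Finite) (hAT : A ⊆ Subgroup.closure T) :
    ∃ L : ℕ, ∀ a ∈ A, ∀ n, ∀ h ∈ K, (G n).edist (f n h) (f n (a * h)) ≤ L := by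
  have hcl : Subgroup.closure T ≤ K := (Subgroup.closure_le K).2 hTK
  have key : ∀ a ∈ Subgroup.closure T,
      ∃ L : ℕ, ∀ n, ∀ h ∈ K, (G n).edist (f n h) (f n (a * h)) ≤ L := by
    intro a ha
    induction ha using Subgroup.closure_induction with
    | mem t ht => exact ⟨1, by simpa using hG t ht⟩
    | one => exact ⟨0, by simp⟩
    | mul a b _ hb iha ihb =>
      obtain ⟨L, hL⟩ := iha
      obtain ⟨M, hM⟩ := ihb
      refine ⟨M + L, fun n h hh => ?_⟩
      rw [mul_assoc, Nat.cast_add]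
      exact (G n).edist_triangle.trans
        (add_le_add (hM n h hh) (hL n _ (K.mul_mem (hcl hb) hh)))
    | inv a ha iha =>
      obtain ⟨L, hL⟩ := iha
      refine ⟨L, fun n h hh => ?_⟩
      rw [SimpleGraph.edist_comm]
      simpa using hL n _ (K.mul_mem (K.inv_mem (hcl ha)) hh)
  choose! ℓ hℓ using key
  obtain ⟨L, hL⟩ := (hA.image ℓ).bddAbove
  exact ⟨L, fun a ha n h hh => (hℓ a (hAT ha) n h hh).trans
    (Nat.cast_le.2 (hL (Set.mem_image_of_mem ℓ ha)))⟩

theorem exists_generating_set_ncard_eq_minGens (Λ : Type u) [Group Λ] [hΛ : Group.FG Λ] :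
    ∃ T : Set Λ, T.Finite ∧ T.ncard = minGens Λ ∧ Subgroup.closure T = ⊤ := by
  refine Nat.sInf_mem (s := {d | ∃ T : Set Λ, T.Finite ∧ T.ncard = d ∧
    Subgroup.closure T = ⊤}) ?_
  obtain ⟨T, -, hT⟩ := Group.rank_spec Λ
  exact ⟨_, (T : Set Λ), T.finite_toSet, rfl, hT⟩

theorem minGens_le_rank (Λ : Type u) [Group Λ] [Group.FG Λ] : minGens Λ ≤ Group.rank Λ := by
  obtain ⟨T, hT, hcl⟩ := Group.rank_spec Λ
  exact Nat.sInf_le ⟨(T : Set Λ), T.finite_toSet, by rw [Set.ncard_coe_finset, hT], hcl⟩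

theorem edgeNum_nonneg {V : ℕ → Type u} (G : ∀ n, SimpleGraph (V n)) : 0 ≤ edgeNum G := by
  rw [edgeNum, liminf_eq]
  exact Real.sSup_nonneg' ⟨0, Eventually.of_forall fun n => by positivity, le_rfl⟩

theorem cost_le_edgeNum {V : ℕ → Type u} {G H : ∀ n, SimpleGraph (V n)}
    (hH : IsGraphSeq V H) (hGH : GEquiv G H) : cost G ≤ edgeNum H :=
  csInf_le ⟨0, by rintro _ ⟨H', -, -, rfl⟩; exact edgeNum_nonneg H'⟩ ⟨H, hH, hGH, rfl⟩

theorem cayleyQuot_edist_le_one {Γ : Type u} [Group Γ] {N : Subgroup Γ} (hN : N.Normal)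
    {S : Set Γ} {s : Γ} (hs : s ∈ S) (g : Γ) :
    (cayleyQuot N hN S).edist (g : Γ ⧸ N) ((s * g : Γ) : Γ ⧸ N) ≤ 1 := by
  rw [SimpleGraph.edist_le_one_iff_adj_or_eq, or_iff_not_imp_right]
  intro hne
  exact (SimpleGraph.fromRel_adj _ _ _).2 ⟨hne, Or.inl ⟨s, hs, by simp⟩⟩

theorem exists_mul_eq_of_cayleyQuot_adj {Γ : Type u} [Group Γ] {N : Subgroup Γ}
    (hN : N.Normal) {S : Set Γ} {x y : Γ ⧸ N} (h : (cayleyQuot N hN S).Adj x y) :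
    ∃ s ∈ S, ∃ g : Γ, (x = (g : Γ ⧸ N) ∧ y = ((s * g : Γ) : Γ ⧸ N)) ∨
      (y = (g : Γ ⧸ N) ∧ x = ((s * g : Γ) : Γ ⧸ N)) := by
  obtain ⟨-, ⟨s, hs, h⟩ | ⟨s, hs, h⟩⟩ := (SimpleGraph.fromRel_adj _ _ _).1 h
  · obtain ⟨g, rfl⟩ := QuotientGroup.mk_surjective x
    exact ⟨s, hs, g, Or.inl ⟨rfl, by simpa using (eq_mul_inv_iff_mul_eq.1 h).symm⟩⟩
  · obtain ⟨g, rfl⟩ := QuotientGroup.mk_surjective y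
    exact ⟨s, hs, g, Or.inr ⟨rfl, by simpa using (eq_mul_inv_iff_mul_eq.1 h).symm⟩⟩

theorem exists_mul_eq_of_translateGraph_adj {Γ Q : Type*} [Group Γ] [Group Q] {f : Γ →* Q}
    {K : Subgroup Γ} {U : Set Γ} {x y : Q} (h : (translateGraph (K.map f) (f '' U)).Adj x y) :
    ∃ u ∈ U, ∃ g : Γ, (x = f g ∧ y = f (u * g)) ∨ (y = f g ∧ x = f (u * g)) := by
  obtain ⟨-, ⟨⟨g, -, rfl⟩, u, hu, h⟩ | ⟨⟨g, -, rfl⟩, u, hu, h⟩⟩ :=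
    translateGraph_adj.1 h
  · exact ⟨u, hu, g, Or.inl ⟨rfl, by simpa using (eq_mul_inv_iff_mul_eq.1 h).symm⟩⟩
  · exact ⟨u, hu, g, Or.inr ⟨rfl, by simpa using (eq_mul_inv_iff_mul_eq.1 h).symm⟩⟩

theorem index_mul_card_map_mk' {Γ : Type*} [Group Γ] {N K : Subgroup Γ} [N.Normal]
    (h : N ≤ K) : K.index * Nat.card (K.map (QuotientGroup.mk' N)) = N.index := by
  have hi : (K.map (QuotientGroup.mk' N)).index = K.index :=
    K.index_map_eq (QuotientGroup.mk'_surjective N) (by rwa [QuotientGroup.ker_mk'])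
  rw [mul_comm, ← hi, Subgroup.card_mul_index]
  rfl

/-- If `T` generates `K` and `R` meets every left coset of `K`, then joining `h` to `u * h` for
`h ∈ K` and `u ∈ T ∪ R` yields, in all finite quotients simultaneously, graphs equivalent to the
Cayley graphs. -/
theorem gEquiv_cayleyQuot_translateGraph {Γ : Type u} [Group Γ] {S : Set Γ}
    (hSfin : S.Finite) (hSgen : Subgroup.closure S = ⊤) (N : ℕ → Subgroup Γ)
    [hnorm : ∀ n, (N n).Normal] {K : Subgroup Γ} {T R : Set Γ} (hT : T.Finite)
    (hTK : Subgroup.closure T = K) (hR : R.Finite) (hRK : ∀ g, ∃ r ∈ R, ∃ h ∈ K, g = r * h) :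
    GEquiv (fun n => cayleyQuot (N n) (hnorm n) S) (fun n =>
      translateGraph (K.map (QuotientGroup.mk' (N n))) (QuotientGroup.mk' (N n) '' (T ∪ R))) := by
  set H : ∀ n, SimpleGraph (Γ ⧸ N n) := fun n =>
    translateGraph (K.map (QuotientGroup.mk' (N n))) (QuotientGroup.mk' (N n) '' (T ∪ R))
  have hH₁ : ∀ u ∈ T ∪ R, ∀ n, ∀ h ∈ K, (H n).edist (QuotientGroup.mk' (N n) h)
      (QuotientGroup.mk' (N n) (u * h)) ≤ 1 := fun u hu n h hh => by
    rw [map_mul]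
    exact translateGraph_edist_le_one (Subgroup.mem_map_of_mem _ hh) (Set.mem_image_of_mem _ hu)
  obtain ⟨L, hL⟩ := exists_edist_mul_le (K := ⊤) (fun n => QuotientGroup.mk' (N n))
    (fun n => cayleyQuot (N n) (hnorm n) S) (Set.subset_univ S)
    (fun s hs n g _ => cayleyQuot_edist_le_one (hnorm n) hs g) (hT.union hR)
    (by rw [hSgen]; exact Set.subset_univ _)
  have hfin : (R⁻¹ * S * R ∩ K).Finite := ((hR.inv.mul hSfin).mul hR).inter_of_left _
  obtain ⟨M, hM⟩ := exists_edist_mul_le (K := K) (fun n => QuotientGroup.mk' (N n)) H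
    (hTK ▸ Subgroup.subset_closure) (fun t ht => hH₁ t (Or.inl ht)) hfin
    (by rw [hTK]; exact Set.inter_subset_right)
  have hHL : ∀ n x y, (H n).Adj x y → (cayleyQuot (N n) (hnorm n) S).edist x y ≤ L := by
    intro n x y hxy
    obtain ⟨u, hu, g, ⟨rfl, rfl⟩ | ⟨rfl, rfl⟩⟩ := exists_mul_eq_of_translateGraph_adj hxy
    · exact hL u hu n g trivial
    · rw [SimpleGraph.edist_comm]
      exact hL u hu n g trivial
  have hstep : ∀ s ∈ S, ∀ n (g : Γ), (H n).edist (QuotientGroup.mk' (N n) g)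
      (QuotientGroup.mk' (N n) (s * g)) ≤ (1 + M + 1 : ℕ) := by
    intro s hs n g
    obtain ⟨r, hr, h, hh, hg⟩ := hRK g
    obtain ⟨r', hr', h', hh', hg'⟩ := hRK (s * g)
    have hmem : r'⁻¹ * s * r ∈ R⁻¹ * S * R ∩ K := by
      refine ⟨Set.mul_mem_mul (Set.mul_mem_mul (Set.inv_mem_inv.2 hr') hs) hr, ?_⟩
      have : r'⁻¹ * s * r = h' * h⁻¹ := by
        rw [eq_mul_inv_iff_mul_eq, mul_assoc, ← hg, mul_assoc, hg', inv_mul_cancel_left]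
      rw [this]
      exact K.mul_mem hh' (K.inv_mem hh)
    have hmid : r'⁻¹ * s * r * h = h' := by
      rw [mul_assoc, ← hg, mul_assoc, hg', inv_mul_cancel_left]
    have h₁ := hH₁ r (Or.inr hr) n h hh
    have h₂ := hM _ hmem n h hh
    have h₃ := hH₁ r' (Or.inr hr') n h' hh'
    rw [SimpleGraph.edist_comm, ← hg] at h₁
    rw [hmid] at h₂
    rw [← hg'] at h₃
    push_cast
    exact (H n).edist_triangle.trans
      (add_le_add ((H n).edist_triangle.trans (add_le_add h₁ h₂)) h₃)
  have hGM : ∀ n x y, (cayleyQuot (N n) (hnorm n) S).Adj x y →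
      (H n).edist x y ≤ (1 + M + 1 : ℕ) := by
    intro n x y hxy
    obtain ⟨s, hs, g, ⟨rfl, rfl⟩ | ⟨rfl, rfl⟩⟩ := exists_mul_eq_of_cayleyQuot_adj (hnorm n) hxy
    · exact hstep s hs n g
    · rw [SimpleGraph.edist_comm]
      exact hstep s hs n g
  exact ⟨prec_of_edist_le hHL hGM, prec_of_edist_le hGM hHL⟩

theorem cost_cayleyQuot_le {Γ : Type u} [Group Γ] [Group.FG Γ] {S : Set Γ}
    (hSfin : S.Finite) (hSgen : Subgroup.closure S = ⊤) (N : ℕ → Subgroup Γ)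
    [hnorm : ∀ n, (N n).Normal] [hfi : ∀ n, (N n).FiniteIndex]
    (hidx : Tendsto (fun n => (N n).index) atTop atTop) (K : Subgroup Γ) [K.FiniteIndex]
    (hK : ∀ᶠ n in atTop, N n ≤ K) :
    cost (fun n => cayleyQuot (N n) (hnorm n) S) ≤ (minGens ↥K : ℝ) / (K.index : ℝ) + 1 := by
  obtain ⟨T', hT'fin, hT'card, hT'gen⟩ := exists_generating_set_ncard_eq_minGens ↥K
  set T : Set Γ := K.subtype '' T' with hTdef
  have hTfin : T.Finite := hT'fin.image _
  have hTcard : T.ncard ≤ minGens ↥K := hT'card ▸ Set.ncard_image_le hT'fin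
  have hTgen : Subgroup.closure T = K := by
    rw [hTdef, ← MonoidHom.map_closure, hT'gen, ← MonoidHom.range_eq_map, K.range_subtype]
  set R : Set Γ := Set.range fun q : Γ ⧸ K => q.out with hRdef
  have hRfin : R.Finite := Set.finite_range _
  have hRcard : R.ncard ≤ K.index := by
    rw [hRdef, ← Set.image_univ]
    exact (Set.ncard_image_le Set.finite_univ).trans (Set.ncard_univ _).le
  have hRK : ∀ g, ∃ r ∈ R, ∃ h ∈ K, g = r * h := by
    intro g
    obtain ⟨h, hh⟩ := QuotientGroup.mk_out_eq_mul K g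
    exact ⟨_, ⟨(g : Γ ⧸ K), rfl⟩, (h : Γ)⁻¹, K.inv_mem h.2,
      by simp only [hh, mul_inv_cancel_right]⟩
  have hU : (T ∪ R).Finite := hTfin.union hRfin
  have hUcard : (T ∪ R).ncard ≤ minGens ↥K + K.index :=
    (Set.ncard_union_le _ _).trans (add_le_add hTcard hRcard)
  have hUn : ∀ n, (QuotientGroup.mk' (N n) '' (T ∪ R)).ncard ≤ minGens ↥K + K.index := fun n =>
    (Set.ncard_image_le hU).trans hUcard
  refine (cost_le_edgeNum ⟨fun n => inferInstance,
    ⟨2 * (minGens ↥K + K.index), fun n x => ?_⟩, hidx⟩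
    (gEquiv_cayleyQuot_translateGraph hSfin hSgen N hTfin hTgen hRfin hRK)).trans ?_
  · exact (ncard_neighborSet_translateGraph_le (hU.image _) x).trans
      (Nat.mul_le_mul_left 2 (hUn n))
  · refine liminf_le_of_frequently_le (hK.mono fun n hn => ?_).frequently
      (isBoundedUnder_of ⟨0, fun n => by positivity⟩)
    have hidxK : (0 : ℝ) < K.index := Nat.cast_pos.2 (Nat.pos_of_ne_zero K.index_ne_zero_of_finite)
    have hcard : (0 : ℝ) < Nat.card (Γ ⧸ N n) := Nat.cast_pos.2 Nat.card_pos
    rw [div_add_one hidxK.ne', div_le_div_iff₀ hcard hidxK]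
    have hV : Nat.card (Γ ⧸ N n) = K.index * Nat.card (K.map (QuotientGroup.mk' (N n))) :=
      (index_mul_card_map_mk' hn).symm
    have hE := ncard_edgeSet_translateGraph_le (K := K.map (QuotientGroup.mk' (N n)))
      (U := QuotientGroup.mk' (N n) '' (T ∪ R))
    have hE' := Nat.mul_le_mul_right K.index (hE.trans (Nat.mul_le_mul_left _ (hUn n)))
    rw [hV]
    exact_mod_cast hE'.trans (le_of_eq (by ring))

theorem cost_sub_one_le_rank_gradient {Γ : Type u} [Group Γ] (S : Set Γ)
    (hSfin : S.Finite) (hSsym : ∀ s ∈ S, s⁻¹ ∈ S) (hSgen : Subgroup.closure S = ⊤)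
    (N : ℕ → Subgroup Γ) (hnorm : ∀ n, (N n).Normal)
    (hnested : ∀ n, N (n + 1) ≤ N n) (hfi : ∀ n, (N n).FiniteIndex)
    (hinter : ⨅ n, N n = ⊥)
    (hidx : Tendsto (fun n => (N n).index) atTop atTop) :
    cost (fun n => cayleyQuot (N n) (hnorm n) S) - 1 ≤
      liminf (fun n => (minGens ↥(N n) : ℝ) / ((N n).index : ℝ)) atTop := by
  have : Group.FG Γ := ⟨⟨hSfin.toFinset, by rwa [hSfin.coe_toFinset]⟩⟩
  have hbdd : ∀ n, (minGens ↥(N n) : ℝ) / ((N n).index : ℝ) ≤ Group.rank Γ := fun n => by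
    have hpos : (0 : ℝ) < (N n).index :=
      Nat.cast_pos.2 (Nat.pos_of_ne_zero (N n).index_ne_zero_of_finite)
    rw [div_le_iff₀' hpos]
    exact_mod_cast (minGens_le_rank ↥(N n)).trans (N n).rank_le_index_mul_rank
  refine le_liminf_of_le (isBoundedUnder_of ⟨_, hbdd⟩).isCoboundedUnder_ge
    (Eventually.of_forall fun m => sub_le_iff_le_add.2 ?_)
  exact cost_cayleyQuot_le hSfin hSgen N hidx (N m)
    ((eventually_ge_atTop m).mono fun n hn => antitone_nat_of_succ_le hnested hn)

end GraphSeqPaper
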